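/- arXiv:2304.10028 — 10 statements merged into one kernel-verified Lean document; each statement's English description precedes it below -/
import Mathlib

section
/- Let n ≥ 1 and let a : Fin n → ℕ satisfy a i ≥ 1 for all i. If the density ∑_{i : Fin n} 1/(a i) is at most 2 (as a real number), then there exist three pairwise disjoint sets S₁, S₂, S₃ ⊆ Fin n with S₁ ∪ S₂ ∪ S₃ = Fin n such that each S_j admits a pinwheel schedule. -/
/-- A subset `S` of the objects admits a pinwheel schedule for the window lengths `a`:
there is an infinite schedule `σ` such that every `i ∈ S` appears at least once in
any `a i` consecutive time steps. -/
def HasPinwheelSchedule {n : ℕ} (a : Fin n → ℕ) (S : Set (Fin n)) : Prop :=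
  ∃ σ : ℕ → Fin n, ∀ i ∈ S, ∀ t : ℕ, ∃ s : ℕ, t ≤ s ∧ s < t + a i ∧ σ s = i

lemma pw_scale {ι : Type*} (e : ι → ℕ) (s : Finset ι) (M : ℕ) (h : ∀ x ∈ s, e x ≤ M) :
    (∑ x ∈ s, (1:ℝ) / 2 ^ (e x)) * 2 ^ M = ((∑ x ∈ s, 2 ^ (M - e x) : ℕ) : ℝ) := by
  rw [Finset.sum_mul]
  push_cast
  apply Finset.sum_congr rfl
  intro x hx
  obtain ⟨d, hd⟩ := Nat.exists_eq_add_of_le (h x hx)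
  rw [hd, Nat.add_sub_cancel_left, pow_add]
  field_simp

lemma pw_slots {ι : Type*} [DecidableEq ι] (c : ℕ) (hc : 0 < c) (e : ι → ℕ) (S : Finset ι) :
    (∑ x ∈ S, (1:ℝ) / 2 ^ (e x)) ≤ c →
    ∃ r : ι → ℕ, (∀ i ∈ S, r i < c * 2 ^ e i) ∧
      ∀ i ∈ S, ∀ j ∈ S, ∀ t, t % (c * 2 ^ e i) = r i → t % (c * 2 ^ e j) = r j → i = j := by
  induction S using Finset.induction_on_max_value e with
  | empty => intro _; exact ⟨fun _ => 0, by simp, by simp⟩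
  | insert i s his hmax ih =>
    intro hsum
    rw [Finset.sum_insert his] at hsum
    have hpos : (0:ℝ) < 1 / 2 ^ e i := by positivity
    obtain ⟨r, hr1, hr2⟩ := ih (by linarith)
    have hsc := pw_scale e s (e i) hmax
    have hlt : (∑ x ∈ s, 2 ^ (e i - e x) : ℕ) < c * 2 ^ e i := by
      have : ((∑ x ∈ s, 2 ^ (e i - e x) : ℕ) : ℝ) < ((c * 2 ^ e i : ℕ) : ℝ) := by
        rw [← hsc]
        push_cast
        apply mul_lt_mul_of_pos_right _ (by positivity)
        linarith
      exact_mod_cast this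
    have hfree : ∃ ρ ∈ Finset.range (c * 2 ^ e i), ρ ∉ s.biUnion
        (fun j => (Finset.range (2 ^ (e i - e j))).image (fun q => r j + (c * 2 ^ e j) * q)) := by
      apply Finset.exists_mem_notMem_of_card_lt_card
      rw [Finset.card_range]
      refine lt_of_le_of_lt Finset.card_biUnion_le (lt_of_le_of_lt ?_ hlt)
      apply Finset.sum_le_sum
      intro j _
      exact Finset.card_image_le.trans (by simp)
    obtain ⟨ρ, hρ1, hρ2⟩ := hfree
    rw [Finset.mem_range] at hρ1
    have key : ∀ j ∈ s, ∀ t, t % (c * 2 ^ e i) = ρ → t % (c * 2 ^ e j) = r j → False := by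
      intro j hj t h1 h2
      apply hρ2
      rw [Finset.mem_biUnion]
      refine ⟨j, hj, ?_⟩
      rw [Finset.mem_image]
      have hdvd : c * 2 ^ e i = (c * 2 ^ e j) * 2 ^ (e i - e j) := by
        rw [mul_assoc, ← pow_add, Nat.add_sub_cancel' (hmax j hj)]
      have h3 : ρ % (c * 2 ^ e j) = r j := by
        rw [← h1, Nat.mod_mod_of_dvd _ ⟨_, hdvd⟩, h2]
      refine ⟨ρ / (c * 2 ^ e j), ?_, ?_⟩
      · rw [Finset.mem_range]
        apply Nat.div_lt_of_lt_mul
        rw [← hdvd]; exact hρ1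
      · rw [← h3]; exact Nat.mod_add_div _ _
    refine ⟨Function.update r i ρ, ?_, ?_⟩
    · intro j hj
      by_cases hji : j = i
      · subst hji; simpa using hρ1
      · rw [Function.update_of_ne hji]
        exact hr1 j ((Finset.mem_insert.1 hj).resolve_left hji)
    · intro j hj l hl t h1 h2
      by_cases hji : j = i <;> by_cases hli : l = i
      · rw [hji, hli]
      · exfalso
        subst hji
        rw [Function.update_of_ne hli] at h2
        rw [Function.update_self] at h1
        exact key l ((Finset.mem_insert.1 hl).resolve_left hli) t h1 h2
      · exfalso
        subst hli
        rw [Function.update_of_ne hji] at h1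
        rw [Function.update_self] at h2
        exact key j ((Finset.mem_insert.1 hj).resolve_left hji) t h2 h1
      · rw [Function.update_of_ne hli] at h2
        rw [Function.update_of_ne hji] at h1
        exact hr2 j ((Finset.mem_insert.1 hj).resolve_left hji) l
          ((Finset.mem_insert.1 hl).resolve_left hli) t h1 h2

lemma pw_fill {ι : Type*} [DecidableEq ι] (c : ℕ) (e : ι → ℕ) (S : Finset ι) :
    (c:ℝ) ≤ (∑ x ∈ S, (1:ℝ) / 2 ^ (e x)) →
    ∃ U ⊆ S, (∑ x ∈ U, (1:ℝ) / 2 ^ (e x)) = c := by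
  induction S using Finset.induction_on_max_value e with
  | empty =>
    intro h
    refine ⟨∅, by simp, ?_⟩
    simp only [Finset.sum_empty] at h ⊢
    exact le_antisymm (by positivity) h
  | insert i s his hmax ih =>
    intro h
    by_cases hs : (c:ℝ) ≤ (∑ x ∈ s, (1:ℝ) / 2 ^ (e x))
    · obtain ⟨U, hU, h2⟩ := ih hs
      exact ⟨U, hU.trans (Finset.subset_insert _ _), h2⟩
    · refine ⟨_, subset_rfl, ?_⟩
      push Not at hs
      rw [Finset.sum_insert his] at h ⊢
      have hsc := pw_scale e s (e i) hmax
      have hp : (0:ℝ) < 2 ^ e i := by positivity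
      have hlt : (∑ x ∈ s, 2 ^ (e i - e x) : ℕ) < c * 2 ^ e i := by
        have : ((∑ x ∈ s, 2 ^ (e i - e x) : ℕ) : ℝ) < ((c * 2 ^ e i : ℕ) : ℝ) := by
          rw [← hsc]
          push_cast
          exact mul_lt_mul_of_pos_right hs hp
        exact_mod_cast this
      have hle : ((∑ x ∈ s, 2 ^ (e i - e x) : ℕ) : ℝ) + 1 ≤ c * 2 ^ e i := by
        exact_mod_cast hlt
      rw [← hsc] at hle
      apply le_antisymm _ h
      have : (1 / 2 ^ e i + ∑ x ∈ s, (1:ℝ) / 2 ^ (e x)) * 2 ^ e i ≤ c * 2 ^ e i := by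
        rw [add_mul, one_div, inv_mul_cancel₀ hp.ne']
        simp only [one_div] at hle ⊢
        linarith
      exact le_of_mul_le_mul_right this hp

lemma pw_sched {n : ℕ} (hn : 1 ≤ n) (a : Fin n → ℕ) (c : ℕ) (hc : 0 < c) (e : Fin n → ℕ)
    (S : Finset (Fin n)) (hle : ∀ i ∈ S, c * 2 ^ e i ≤ a i)
    (hsum : (∑ x ∈ S, (1:ℝ) / 2 ^ (e x)) ≤ c) : HasPinwheelSchedule a (S : Set (Fin n)) := by
  classical
  obtain ⟨r, hr1, hr2⟩ := pw_slots c hc e S hsum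
  refine ⟨fun t => if h : ∃ i ∈ S, t % (c * 2 ^ e i) = r i then h.choose else ⟨0, hn⟩, ?_⟩
  intro i hi t
  have hi : i ∈ S := hi
  set m := c * 2 ^ e i with hm
  have hm0 : 0 < m := by positivity
  have hrm : r i < m := hr1 i hi
  have hex : ∃ s, t ≤ s ∧ s < t + m ∧ s % m = r i := by
    have h1 := Nat.mod_add_div t m
    have h2 := Nat.mod_lt t hm0
    by_cases hc : t % m ≤ r i
    · refine ⟨r i + m * (t / m), by omega, by omega, ?_⟩
      rw [Nat.add_mul_mod_self_left, Nat.mod_eq_of_lt hrm]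
    · refine ⟨r i + m * (t / m + 1), ?_, ?_, ?_⟩
      · rw [mul_add]; omega
      · rw [mul_add]; omega
      · rw [Nat.add_mul_mod_self_left, Nat.mod_eq_of_lt hrm]
  obtain ⟨s, h1, h2, h3⟩ := hex
  refine ⟨s, h1, lt_of_lt_of_le h2 (Nat.add_le_add_left (hle i hi) t), ?_⟩
  have h : ∃ i ∈ S, s % (c * 2 ^ e i) = r i := ⟨i, hi, h3⟩
  simp only [dif_pos h]
  exact hr2 _ h.choose_spec.1 i hi s h.choose_spec.2 h3

lemma pw_alt {n : ℕ} (hn : 1 ≤ n) (a : Fin n → ℕ) (ha : ∀ i, 1 ≤ a i)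
    (c : ℕ) (hc : 0 < c) (e : Fin n → ℕ) (δ : ℝ)
    (S : Finset (Fin n)) (hle : ∀ i ∈ S, c * 2 ^ e i ≤ a i)
    (hδ : ∀ i ∈ S, δ * a i < c * 2 ^ e i) :
    HasPinwheelSchedule a (S : Set (Fin n)) ∨
    ∃ U ⊆ S, HasPinwheelSchedule a (U : Set (Fin n)) ∧ δ < ∑ i ∈ U, (1:ℝ) / a i := by
  by_cases h : (∑ x ∈ S, (1:ℝ) / 2 ^ (e x)) ≤ c
  · exact Or.inl (pw_sched hn a c hc e S hle h)
  · right
    obtain ⟨U, hU, hs⟩ := pw_fill c e S (le_of_not_ge h)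
    refine ⟨U, hU, pw_sched hn a c hc e U (fun i hi => hle i (hU hi)) hs.le, ?_⟩
    have hc' : (0:ℝ) < c := by exact_mod_cast hc
    have hne : U.Nonempty := by
      rw [Finset.nonempty_iff_ne_empty]
      rintro rfl
      simp at hs
      linarith
    have : ∑ i ∈ U, (δ / c) * ((1:ℝ) / 2 ^ (e i)) < ∑ i ∈ U, (1:ℝ) / a i := by
      apply Finset.sum_lt_sum_of_nonempty hne
      intro i hi
      have h1 := hδ i (hU hi)
      have h2 : (0:ℝ) < a i := by exact_mod_cast ha i
      rw [div_mul_div_comm, mul_one, div_lt_div_iff₀ (by positivity) h2]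
      linarith
    rw [← Finset.mul_sum, hs, div_mul_cancel₀ _ hc'.ne'] at this
    exact this

lemma pw_one {n : ℕ} (hn : 1 ≤ n) (a : Fin n → ℕ) (ha : ∀ i, 1 ≤ a i)
    (k : Fin n → ℕ) (hk1 : ∀ i, 2 ^ k i ≤ a i) (hk2 : ∀ i, a i < 2 * 2 ^ k i)
    (S : Finset (Fin n)) (hd : ∑ i ∈ S, (1:ℝ) / a i ≤ 7 / 12) :
    HasPinwheelSchedule a (S : Set (Fin n)) := by
  have hapos : ∀ i, (0:ℝ) < a i := fun i => by exact_mod_cast ha i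
  have hk2r : ∀ i, (1:ℝ) / 2 ^ k i ≤ 2 * (1 / a i) := by
    intro i
    have h : (a i : ℝ) < 2 * 2 ^ k i := by exact_mod_cast hk2 i
    rw [mul_one_div, div_le_div_iff₀ (by positivity) (hapos i)]
    linarith
  by_cases hW : (∑ x ∈ S, (1:ℝ) / 2 ^ (k x)) ≤ 1
  · exact pw_sched hn a 1 one_pos k S (fun i _ => by simpa using hk1 i) (by simpa using hW)
  push Not at hW
  -- no item of size at most two
  have hbig : ∀ i ∈ S, 3 ≤ a i := by
    intro i hi
    by_contra hlt
    have hle : a i ≤ 2 := by omega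
    have hsplit := Finset.add_sum_erase S (fun i => (1:ℝ) / a i) hi
    have hsplit2 := Finset.add_sum_erase S (fun i => (1:ℝ) / 2 ^ k i) hi
    have hrest : ∑ j ∈ S.erase i, (1:ℝ) / 2 ^ k j ≤ 2 * ∑ j ∈ S.erase i, (1:ℝ) / a j := by
      rw [Finset.mul_sum]
      exact Finset.sum_le_sum (fun j _ => hk2r j)
    have hnn : 0 ≤ ∑ j ∈ S.erase i, (1:ℝ) / a j := Finset.sum_nonneg (fun j _ => by positivity)
    have h1 := ha i
    have h2 := hk1 i
    have h3 := hk2 i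
    have : a i = 1 ∨ a i = 2 := by omega
    rcases this with h | h
    · rw [h] at hsplit; norm_num at hsplit hd hnn; linarith
    · have hk : k i = 1 := by
        rw [h] at h2 h3
        rcases hki : k i with _ | _ | m
        · rw [hki] at h3; norm_num at h3
        · rfl
        · rw [hki, pow_succ, pow_succ] at h2
          have := Nat.one_le_two_pow (n := m)
          omega
      rw [h] at hsplit
      rw [hk] at hsplit2
      norm_num at hsplit hsplit2 hd hW hrest
      linarith
  have hE : ∀ i, ∃ e : ℕ, i ∈ S → 3 * 2 ^ e ≤ a i ∧
      (1:ℝ) / 2 ^ e + 4 * (1 / 2 ^ k i) ≤ 12 * (1 / a i) := by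
    intro i
    by_cases hi : i ∈ S
    swap
    · exact ⟨0, fun h => absurd h hi⟩
    have h3 := hbig i hi
    have h1 := hk1 i
    have h2 := hk2 i
    by_cases hc : 3 * 2 ^ k i ≤ 2 * a i
    · rcases hki : k i with _ | m
      · rw [hki] at h2; norm_num at h2; omega
      · rw [hki, pow_succ] at h1 h2 hc
        refine ⟨m, fun _ => ⟨by omega, ?_⟩⟩
        have h : (a i : ℝ) < 2 * (2 ^ m * 2) := by exact_mod_cast h2
        have e1 : (1:ℝ) / 2 ^ m + 4 * (1 / 2 ^ (m+1)) = 3 / 2 ^ m := by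
          rw [pow_succ]; field_simp; norm_num
        rw [e1, mul_one_div, div_le_div_iff₀ (by positivity) (hapos i)]
        linarith
    · rcases hki : k i with _ | _ | m
      · rw [hki] at h2; norm_num at h2; omega
      · rw [hki] at h2 hc; norm_num at h2 hc; omega
      · rw [hki, pow_succ, pow_succ] at h1 h2 hc
        refine ⟨m, fun _ => ⟨by omega, ?_⟩⟩
        have h : (2:ℝ) * a i < 3 * (2 ^ m * 2 * 2) := by exact_mod_cast (not_le.1 hc)
        have e1 : (1:ℝ) / 2 ^ m + 4 * (1 / 2 ^ (m+1+1)) = 2 / 2 ^ m := by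
          rw [pow_succ, pow_succ]; field_simp; norm_num
        rw [e1, mul_one_div, div_le_div_iff₀ (by positivity) (hapos i)]
        linarith
  choose e he using hE
  refine pw_sched hn a 3 (by norm_num) e S (fun i hi => (he i hi).1) ?_
  have := Finset.sum_le_sum (fun i hi => (he i hi).2)
  rw [Finset.sum_add_distrib, ← Finset.mul_sum, ← Finset.mul_sum] at this
  push_cast
  linarith

lemma pw_c3 {n : ℕ} (a : Fin n → ℕ) (ha : ∀ i, 1 ≤ a i)
    (k : Fin n → ℕ) (hk1 : ∀ i, 2 ^ k i ≤ a i) (hk2 : ∀ i, a i < 2 * 2 ^ k i) :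
    ∃ e : Fin n → ℕ, ∀ i, 3 * 2 ^ k i ≤ 2 * a i →
      3 * 2 ^ e i ≤ a i ∧ (3/4 : ℝ) * a i < (3:ℕ) * 2 ^ e i := by
  refine ⟨fun i => k i - 1, fun i hc => ?_⟩
  have h1 := hk1 i
  have h2 := hk2 i
  rcases hki : k i with _ | m
  · rw [hki] at h2 hc; norm_num at h2 hc; omega
  · rw [hki, pow_succ] at h2 hc
    have hm : k i - 1 = m := by omega
    simp only [hm]
    have h : (a i : ℝ) < 2 * (2 ^ m * 2) := by exact_mod_cast h2
    refine ⟨by omega, ?_⟩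
    push_cast
    linarith

lemma pw_c2 {n : ℕ} (a : Fin n → ℕ)
    (k : Fin n → ℕ) (hk1 : ∀ i, 2 ^ k i ≤ a i) :
    ∃ e : Fin n → ℕ, ∀ i, ¬ 3 * 2 ^ k i ≤ 2 * a i → 5 * 2 ^ k i ≤ 4 * a i →
      5 * 2 ^ e i ≤ a i ∧ (3/4 : ℝ) * a i < (5:ℕ) * 2 ^ e i := by
  refine ⟨fun i => k i - 2, fun i hc hc' => ?_⟩
  have h1 := hk1 i
  rcases hki : k i with _ | _ | m
  · rw [hki] at hc hc'; norm_num at hc hc'; omega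
  · rw [hki] at hc hc'; norm_num at hc hc'; omega
  · rw [hki, pow_succ, pow_succ] at hc hc'
    have hm : k i - 2 = m := by omega
    simp only [hm]
    have h : (2:ℝ) * a i < 3 * (2 ^ m * 2 * 2) := by exact_mod_cast (not_le.1 hc)
    refine ⟨by omega, ?_⟩
    have hp : (0:ℝ) < 2 ^ m := by positivity
    push_cast
    linarith

lemma pw_two {n : ℕ} (hn : 1 ≤ n) (a : Fin n → ℕ) (ha : ∀ i, 1 ≤ a i)
    (k : Fin n → ℕ) (hk1 : ∀ i, 2 ^ k i ≤ a i) (hk2 : ∀ i, a i < 2 * 2 ^ k i)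
    (S : Finset (Fin n)) (hd : ∑ i ∈ S, (1:ℝ) / a i ≤ 5 / 4) :
    ∃ U ⊆ S, HasPinwheelSchedule a (U : Set (Fin n)) ∧
      HasPinwheelSchedule a ((S \ U : Finset (Fin n)) : Set (Fin n)) := by
  obtain ⟨e3, he3⟩ := pw_c3 a ha k hk1 hk2
  have hfin : ∀ U ⊆ S, 2/3 < ∑ i ∈ U, (1:ℝ) / a i →
      HasPinwheelSchedule a ((S \ U : Finset (Fin n)) : Set (Fin n)) := by
    intro U hU h
    apply pw_one hn a ha k hk1 hk2
    have := Finset.sum_sdiff (f := fun i => (1:ℝ) / a i) hU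
    linarith
  rcases pw_alt hn a ha 3 (by norm_num) e3 (3/4) (S.filter (fun i => 3 * 2 ^ k i ≤ 2 * a i))
    (fun i hi => (he3 i (Finset.mem_filter.1 hi).2).1)
    (fun i hi => (he3 i (Finset.mem_filter.1 hi).2).2) with h3 | ⟨U, hU, hs, hdU⟩
  swap
  · have hU' := hU.trans (Finset.filter_subset _ _)
    exact ⟨U, hU', hs, hfin U hU' (by linarith)⟩
  rcases pw_alt hn a ha 1 (by norm_num) k (2/3) (S \ S.filter (fun i => 3 * 2 ^ k i ≤ 2 * a i))
    (fun i hi => by simpa using hk1 i)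
    (fun i hi => by
      simp only [Finset.mem_sdiff, Finset.mem_filter, not_and, not_le] at hi
      have h : (2:ℝ) * a i < 3 * 2 ^ k i := by exact_mod_cast hi.2 hi.1
      push_cast
      linarith) with h1 | ⟨U, hU, hs, hdU⟩
  · exact ⟨_, Finset.filter_subset _ _, h3, h1⟩
  · have hU' := hU.trans Finset.sdiff_subset
    exact ⟨U, hU', hs, hfin U hU' hdU⟩

theorem pinwheel_partition_three (n : ℕ) (hn : 1 ≤ n) (a : Fin n → ℕ)
    (ha : ∀ i, 1 ≤ a i)
    (hdens : ∑ i : Fin n, (1 : ℝ) / (a i : ℝ) ≤ 2) :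
    ∃ S₁ S₂ S₃ : Set (Fin n),
      Disjoint S₁ S₂ ∧ Disjoint S₁ S₃ ∧ Disjoint S₂ S₃ ∧
      S₁ ∪ S₂ ∪ S₃ = Set.univ ∧
      HasPinwheelSchedule a S₁ ∧ HasPinwheelSchedule a S₂ ∧
      HasPinwheelSchedule a S₃ := by
  have hK : ∀ i, ∃ k : ℕ, 2 ^ k ≤ a i ∧ a i < 2 * 2 ^ k := fun i =>
    ⟨Nat.log 2 (a i), Nat.pow_log_le_self 2 (by have := ha i; omega), by
      have := Nat.lt_pow_succ_log_self (b := 2) (by norm_num) (a i)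
      rw [pow_succ] at this
      omega⟩
  choose k hk using hK
  have hk1 := fun i => (hk i).1
  have hk2 := fun i => (hk i).2
  have hfin : ∀ U : Finset (Fin n), HasPinwheelSchedule a (U : Set (Fin n)) →
      3/4 < ∑ i ∈ U, (1:ℝ) / a i → ∃ S₁ S₂ S₃ : Set (Fin n),
      Disjoint S₁ S₂ ∧ Disjoint S₁ S₃ ∧ Disjoint S₂ S₃ ∧
      S₁ ∪ S₂ ∪ S₃ = Set.univ ∧
      HasPinwheelSchedule a S₁ ∧ HasPinwheelSchedule a S₂ ∧
      HasPinwheelSchedule a S₃ := by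
    intro U hs h
    have := Finset.sum_sdiff (f := fun i => (1:ℝ) / a i) (Finset.subset_univ U)
    obtain ⟨V, hV, h1, h2⟩ := pw_two hn a ha k hk1 hk2 (Finset.univ \ U) (by linarith)
    refine ⟨U, V, _, ?_, ?_, ?_, ?_, hs, h1, h2⟩
    · rw [Finset.disjoint_coe, Finset.disjoint_left]
      intro x hx hx'
      have := hV hx'
      simp [hx] at this
    · rw [Finset.disjoint_coe, Finset.disjoint_left]
      intro x hx hx'
      simp [hx] at hx'
    · rw [Finset.disjoint_coe]
      exact Finset.disjoint_sdiff
    · ext x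
      simp only [Set.mem_union, Finset.mem_coe, Finset.mem_sdiff, Finset.mem_univ, true_and,
        Set.mem_univ, iff_true]
      tauto
  obtain ⟨e3, he3⟩ := pw_c3 a ha k hk1 hk2
  obtain ⟨e2, he2⟩ := pw_c2 a k hk1
  rcases pw_alt hn a ha 3 (by norm_num) e3 (3/4)
    (Finset.univ.filter (fun i => 3 * 2 ^ k i ≤ 2 * a i))
    (fun i hi => (he3 i (Finset.mem_filter.1 hi).2).1)
    (fun i hi => (he3 i (Finset.mem_filter.1 hi).2).2) with h3 | ⟨U, hU, hs, hdU⟩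
  swap
  · exact hfin U hs hdU
  rcases pw_alt hn a ha 5 (by norm_num) e2 (3/4)
    (Finset.univ.filter (fun i => ¬ 3 * 2 ^ k i ≤ 2 * a i ∧ 5 * 2 ^ k i ≤ 4 * a i))
    (fun i hi => (he2 i (Finset.mem_filter.1 hi).2.1 (Finset.mem_filter.1 hi).2.2).1)
    (fun i hi => (he2 i (Finset.mem_filter.1 hi).2.1 (Finset.mem_filter.1 hi).2.2).2)
    with h2 | ⟨U, hU, hs, hdU⟩
  swap
  · exact hfin U hs hdU
  rcases pw_alt hn a ha 1 (by norm_num) k (3/4)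
    (Finset.univ.filter (fun i => ¬ 3 * 2 ^ k i ≤ 2 * a i ∧ ¬ 5 * 2 ^ k i ≤ 4 * a i))
    (fun i hi => by simpa using hk1 i)
    (fun i hi => by
      have h : (4:ℝ) * a i < 5 * 2 ^ k i := by
        exact_mod_cast not_le.1 (Finset.mem_filter.1 hi).2.2
      have hp : (0:ℝ) < 2 ^ k i := by positivity
      push_cast
      linarith)
    with h1 | ⟨U, hU, hs, hdU⟩
  swap
  · exact hfin U hs hdU
  refine ⟨_, _, _, ?_, ?_, ?_, ?_, h3, h2, h1⟩
  · rw [Finset.disjoint_coe, Finset.disjoint_left]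
    intro x hx hx'
    exact (Finset.mem_filter.1 hx').2.1 (Finset.mem_filter.1 hx).2
  · rw [Finset.disjoint_coe, Finset.disjoint_left]
    intro x hx hx'
    exact (Finset.mem_filter.1 hx').2.1 (Finset.mem_filter.1 hx).2
  · rw [Finset.disjoint_coe, Finset.disjoint_left]
    intro x hx hx'
    exact (Finset.mem_filter.1 hx').2.2 (Finset.mem_filter.1 hx).2.2
  · ext x
    simp only [Set.mem_union, Finset.mem_coe, Finset.mem_filter, Finset.mem_univ, true_and,
      Set.mem_univ, iff_true]
    tauto
end

section
/- Let n ≥ 1 and let s, e : Fin n → ℝ satisfy s i ≤ e i for all i. Then the set { ((max over i of x i) + (min over i of x i))/2 | x : Fin n → ℝ such that x i ∈ Set.Icc (s i) (e i) for every i } equals the closed interval Set.Icc (((max over i of s i) + (min over i of s i))/2) (((max over i of e i) + (min over i of e i))/2). In particular, the metric diameter of this set equals the average of (max_i e i − max_i s i) and (min_i e i − min_i s i). -/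
theorem oneCenter_uncertainty_region (n : ℕ) (hn : 1 ≤ n) (s e : Fin n → ℝ)
    (hse : ∀ i, s i ≤ e i) :
    { m : ℝ | ∃ x : Fin n → ℝ,
        (∀ i, x i ∈ Set.Icc (s i) (e i)) ∧
        m = ((⨆ i, x i) + (⨅ i, x i)) / 2 }
      = Set.Icc (((⨆ i, s i) + (⨅ i, s i)) / 2) (((⨆ i, e i) + (⨅ i, e i)) / 2)
    ∧ Metric.diam { m : ℝ | ∃ x : Fin n → ℝ,
        (∀ i, x i ∈ Set.Icc (s i) (e i)) ∧
        m = ((⨆ i, x i) + (⨅ i, x i)) / 2 }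
      = (((⨆ i, e i) - (⨆ i, s i)) + ((⨅ i, e i) - (⨅ i, s i))) / 2 := by
  haveI : Nonempty (Fin n) := ⟨⟨0, hn⟩⟩
  have hA : ∀ x : Fin n → ℝ, BddAbove (Set.range x) := fun x => (Set.finite_range x).bddAbove
  have hB : ∀ x : Fin n → ℝ, BddBelow (Set.range x) := fun x => (Set.finite_range x).bddBelow
  have mono : ∀ x y : Fin n → ℝ, (∀ i, x i ≤ y i) →
      ((⨆ i, x i) + (⨅ i, x i)) / 2 ≤ ((⨆ i, y i) + (⨅ i, y i)) / 2 := by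
    intro x y h
    have h1 := ciSup_mono (hA y) h
    have h2 := ciInf_mono (hB x) h
    linarith
  have key : { m : ℝ | ∃ x : Fin n → ℝ,
        (∀ i, x i ∈ Set.Icc (s i) (e i)) ∧
        m = ((⨆ i, x i) + (⨅ i, x i)) / 2 }
      = Set.Icc (((⨆ i, s i) + (⨅ i, s i)) / 2) (((⨆ i, e i) + (⨅ i, e i)) / 2) := by
    ext m
    constructor
    · rintro ⟨x, hx, rfl⟩
      exact ⟨mono _ _ fun i => (hx i).1, mono _ _ fun i => (hx i).2⟩
    · intro hm
      let f : ℝ → Fin n → ℝ := fun t i => s i + t * (e i - s i)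
      have hc : Continuous fun t => ((⨆ i, f t i) + (⨅ i, f t i)) / 2 := by
        simp only [← Finset.sup'_univ_eq_ciSup, ← Finset.inf'_univ_eq_ciInf]
        refine Continuous.div_const (Continuous.add ?_ ?_) 2
        · exact Continuous.finset_sup'_apply _ (fun i _ => by fun_prop)
        · exact Continuous.finset_inf'_apply _ (fun i _ => by fun_prop)
      have hi := intermediate_value_Icc (zero_le_one (α := ℝ)) hc.continuousOn
      have h0 : f 0 = s := by funext i; simp [f]
      have h1 : f 1 = e := by funext i; simp [f]
      simp only [h0, h1] at hi
      obtain ⟨t, ht, hmt⟩ := hi hm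
      refine ⟨f t, fun i => ⟨?_, ?_⟩, hmt.symm⟩
      · have := mul_nonneg ht.1 (sub_nonneg.2 (hse i))
        simp only [f]; linarith
      · have := mul_le_of_le_one_left (sub_nonneg.2 (hse i)) ht.2
        simp only [f]; linarith
  refine ⟨key, ?_⟩
  rw [key, Real.diam_Icc (mono s e hse)]
  ring
end

section
/- Let d ≥ 1, let E = EuclideanSpace ℝ (Fin d), and let S ⊆ E be a nonempty finite set. If c ∈ E minimizes the function x ↦ max_{p ∈ S} dist x p over all of E (i.e., for every y ∈ E, max_{p ∈ S} dist c p ≤ max_{p ∈ S} dist y p), then c lies in the convex hull of S. -/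
theorem oneCenter_mem_convexHull (d : ℕ) (hd : 1 ≤ d)
    (S : Finset (EuclideanSpace ℝ (Fin d))) (hS : S.Nonempty)
    (c : EuclideanSpace ℝ (Fin d))
    (hc : ∀ y : EuclideanSpace ℝ (Fin d),
      S.sup' hS (fun p => dist c p) ≤ S.sup' hS (fun p => dist y p)) :
    c ∈ convexHull ℝ (S : Set (EuclideanSpace ℝ (Fin d))) := by
  by_contra hcn
  have hcomp : IsComplete (convexHull ℝ (S : Set (EuclideanSpace ℝ (Fin d)))) :=
    (S.finite_toSet.isCompact_convexHull ℝ).isComplete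
  have hne : (convexHull ℝ (S : Set (EuclideanSpace ℝ (Fin d)))).Nonempty := by
    rw [convexHull_nonempty_iff]; exact hS
  obtain ⟨v, hv, hmin⟩ := exists_norm_eq_iInf_of_complete_convex hne hcomp
    (convex_convexHull ℝ _) c
  have hin := (norm_eq_iInf_iff_real_inner_le_zero (convex_convexHull ℝ _) hv).1 hmin
  have hcv : 0 < ‖c - v‖ := by
    rw [norm_pos_iff, sub_ne_zero]
    rintro rfl
    exact hcn hv
  have hlt : ∀ p ∈ S, dist v p < dist c p := by
    intro p hp
    have h1 := hin p (subset_convexHull ℝ _ hp)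
    have h2 := norm_sub_sq_real (c - v) (p - v)
    rw [sub_sub_sub_cancel_right] at h2
    rw [dist_comm v p, dist_eq_norm, dist_eq_norm]
    apply lt_of_pow_lt_pow_left₀ 2 (norm_nonneg _)
    have := pow_pos hcv 2
    linarith
  refine absurd (hc v) (not_le.2 ?_)
  rw [Finset.sup'_lt_iff]
  intro p hp
  exact (hlt p hp).trans_le (Finset.le_sup' (fun p => dist c p) hp)
end

section
/- Let n ≥ 2 and let c : Fin n → ℝ be nonnegative and nonincreasing (c 0 ≥ c 1 ≥ … ≥ c (n−1) ≥ 0). Writing a_i = c(i−1) for i = 1, …, n and L = ⌊log₂ n⌋ + 1, one has ∑_{i=1}^{n} 2·(L · 2^{⌊log₂ i⌋} − 1)·a_i ≤ 3·L·∑_{i=1}^{n−1} 2·i·a_i, where ⌊log₂ i⌋ denotes the base-2 logarithm rounded down (Nat.log 2 i). -/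
theorem grouping_algorithm_ineq (n : ℕ) (hn : 2 ≤ n) (c : Fin n → ℝ)
    (hnonneg : ∀ i, 0 ≤ c i) (hmono : Antitone c) :
    ∑ i : Fin n,
        2 * (((Nat.log 2 n + 1 : ℕ) : ℝ) * 2 ^ (Nat.log 2 ((i : ℕ) + 1)) - 1) * c i
      ≤ 3 * ((Nat.log 2 n + 1 : ℕ) : ℝ) *
          ∑ i : Fin (n - 1), 2 * ((i : ℕ) + 1 : ℝ) * c (Fin.castLE (Nat.sub_le n 1) i) := by
  obtain ⟨k, rfl⟩ : ∃ k, n = k + 2 := ⟨n - 2, by omega⟩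
  generalize Nat.log 2 (k + 2) + 1 = L
  have hL : (0 : ℝ) ≤ (L : ℝ) := Nat.cast_nonneg L
  have h1 : ∑ i : Fin (k + 2), 2 * ((L : ℝ) * 2 ^ (Nat.log 2 ((i : ℕ) + 1)) - 1) * c i
      ≤ ∑ i : Fin (k + 2), (L : ℝ) * (2 * ((i : ℕ) + 1 : ℝ) * c i) := by
    refine Finset.sum_le_sum fun i _ => ?_
    have hp : (2 : ℝ) ^ (Nat.log 2 ((i : ℕ) + 1)) ≤ (i : ℕ) + 1 := by
      exact_mod_cast Nat.pow_log_le_self 2 (Nat.succ_ne_zero (i : ℕ))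
    have h := mul_le_mul_of_nonneg_right (mul_le_mul_of_nonneg_left hp hL) (hnonneg i)
    nlinarith [hnonneg i]
  refine h1.trans ?_
  rw [← Finset.mul_sum, Fin.sum_univ_castSucc]
  change (L : ℝ) * (∑ i : Fin (k + 1), 2 * ((i : ℕ) + 1 : ℝ) * c i.castSucc + _) ≤
    3 * (L : ℝ) * ∑ i : Fin (k + 1), 2 * ((i : ℕ) + 1 : ℝ) * c i.castSucc
  have h2 : 2 * (((Fin.last k : Fin (k + 1)) : ℕ) + 1 : ℝ) * c (Fin.last k).castSucc ≤
      ∑ i : Fin (k + 1), 2 * ((i : ℕ) + 1 : ℝ) * c i.castSucc :=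
    Finset.single_le_sum (f := fun i : Fin (k + 1) => 2 * ((i : ℕ) + 1 : ℝ) * c i.castSucc)
      (fun i _ => mul_nonneg (by positivity) (hnonneg _)) (Finset.mem_univ _)
  have h3 : c (Fin.last (k + 1)) ≤ c (Fin.last k).castSucc := hmono (Fin.le_last _)
  have h4 := hnonneg (Fin.last (k + 1))
  generalize ∑ i : Fin (k + 1), 2 * ((i : ℕ) + 1 : ℝ) * c i.castSucc = S at *
  rw [mul_comm 3 (L : ℝ), mul_assoc (L : ℝ) 3 S]
  refine mul_le_mul_of_nonneg_left ?_ hL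
  simp only [Fin.val_last] at h2 ⊢
  push_cast
  have hk : (0 : ℝ) ≤ k := Nat.cast_nonneg k
  have h5 := mul_le_mul_of_nonneg_left h3 (by positivity : (0 : ℝ) ≤ 2 * ((k : ℝ) + 1))
  nlinarith [mul_nonneg hk h4]
end

section
/- In the query model in ℝ with n ≥ 2 objects, maximum speed v > 0, and the round-robin schedule q t = t mod n: for every valid trajectory family f and every time t, the metric diameter of the 1-center uncertainty region C t = { ((max over i of x i) + (min over i of x i))/2 | x : Fin n → ℝ with x i ∈ U i t for every i } is at most 2·v·(n−1). -/
/-- The last time `s ≤ t` at which the exact position of object `i` was known: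
either `s = 0` (initial positions are known) or object `i` was queried at time `s`. -/
def lastObs {n : ℕ} (q : ℕ → Fin n) (i : Fin n) (t : ℕ) : ℕ :=
  Nat.findGreatest (fun s => s = 0 ∨ q s = i) t

/-- Left endpoint of the uncertainty region of object `i` at time `t`. -/
noncomputable def sPt {n : ℕ} (v : ℝ) (f : Fin n → ℕ → ℝ) (q : ℕ → Fin n)
    (i : Fin n) (t : ℕ) : ℝ :=
  f i (lastObs q i t) - v * ((t - lastObs q i t : ℕ) : ℝ)

/-- Right endpoint of the uncertainty region of object `i` at time `t`. -/
noncomputable def ePt {n : ℕ} (v : ℝ) (f : Fin n → ℕ → ℝ) (q : ℕ → Fin n)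
    (i : Fin n) (t : ℕ) : ℝ :=
  f i (lastObs q i t) + v * ((t - lastObs q i t : ℕ) : ℝ)

/-- The uncertainty region of object `i` at time `t`. -/
noncomputable def uncReg {n : ℕ} (v : ℝ) (f : Fin n → ℕ → ℝ) (q : ℕ → Fin n)
    (i : Fin n) (t : ℕ) : Set ℝ :=
  Set.Icc (sPt v f q i t) (ePt v f q i t)

/-- The round-robin query schedule `q t = t mod n`. -/
def roundRobin (n : ℕ) (hn : 0 < n) : ℕ → Fin n :=
  fun t => ⟨t % n, Nat.mod_lt t hn⟩

theorem rr_gap (n : ℕ) (hn : 0 < n) (i : Fin n) (t : ℕ) :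
    t - lastObs (roundRobin n hn) i t ≤ n - 1 := by
  by_cases h : t < n
  · omega
  · push Not at h
    have hi := i.isLt
    have hr : (t + n - i) % n < n := Nat.mod_lt _ hn
    have hd := Nat.div_add_mod (t + n - i) n
    have hk : 1 ≤ (t + n - i) / n := (Nat.one_le_div_iff hn).2 (by omega)
    obtain ⟨k, hk'⟩ := Nat.exists_eq_add_of_le hk
    rw [hk', Nat.mul_add, Nat.mul_one] at hd
    have hs : t - (t + n - i) % n = i + n * k := by omega
    have : t - (t + n - i) % n ≤ lastObs (roundRobin n hn) i t := by
      unfold lastObs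
      apply Nat.le_findGreatest (Nat.sub_le _ _)
      right
      rw [hs]
      apply Fin.ext
      simp [roundRobin, Nat.mod_eq_of_lt hi]
    omega

theorem rr_aux (n : ℕ) (hn : 0 < n) (D : ℝ) (x y : Fin n → ℝ)
    (h : ∀ i, x i ≤ y i + D) :
    (⨆ i, x i) ≤ (⨆ i, y i) + D ∧ (⨅ i, x i) ≤ (⨅ i, y i) + D := by
  haveI : Nonempty (Fin n) := ⟨⟨0, hn⟩⟩
  constructor
  · apply ciSup_le
    intro i
    have := le_ciSup (Set.finite_range y).bddAbove i
    linarith [h i]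
  · have : (⨅ i, x i) - D ≤ ⨅ i, y i := by
      apply le_ciInf
      intro i
      have := ciInf_le (Set.finite_range x).bddBelow i
      linarith [h i]
    linarith

theorem roundRobin_oneCenter_upper (n : ℕ) (hn : 2 ≤ n) (v : ℝ) (hv : 0 < v)
    (f : Fin n → ℕ → ℝ) (hf : ∀ i t, |f i (t + 1) - f i t| ≤ v) (t : ℕ) :
    Metric.diam { m : ℝ | ∃ x : Fin n → ℝ,
        (∀ i, x i ∈ uncReg v f (roundRobin n (by omega)) i t) ∧
        m = ((⨆ i, x i) + (⨅ i, x i)) / 2 }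
      ≤ 2 * v * ((n : ℝ) - 1) := by
  have hn0 : 0 < n := by omega
  have hn1 : (1 : ℝ) ≤ n := by exact_mod_cast hn0
  have key : ∀ x y : Fin n → ℝ,
      (∀ i, x i ∈ uncReg v f (roundRobin n hn0) i t) →
      (∀ i, y i ∈ uncReg v f (roundRobin n hn0) i t) →
      ∀ i, x i ≤ y i + 2 * v * ((n : ℝ) - 1) := by
    intro x y hx hy i
    have h1 := (hx i).2
    have h2 := (hy i).1
    unfold ePt at h1
    unfold sPt at h2
    have h3 : ((t - lastObs (roundRobin n hn0) i t : ℕ) : ℝ) ≤ (n : ℝ) - 1 := by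
      have := rr_gap n hn0 i t
      have h4 : ((t - lastObs (roundRobin n hn0) i t : ℕ) : ℝ) ≤ ((n - 1 : ℕ) : ℝ) := by
        exact_mod_cast this
      rwa [Nat.cast_sub hn0, Nat.cast_one] at h4
    have h5 := mul_le_mul_of_nonneg_left h3 hv.le
    linarith
  apply Metric.diam_le_of_forall_dist_le
  · have : 0 ≤ (n : ℝ) - 1 := by linarith
    positivity
  · rintro a ⟨x, hx, rfl⟩ b ⟨y, hy, rfl⟩
    obtain ⟨h1, h2⟩ := rr_aux n hn0 _ x y (key x y hx hy)
    obtain ⟨h3, h4⟩ := rr_aux n hn0 _ y x (key y x hy hx)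
    rw [Real.dist_eq, abs_le]
    constructor <;> linarith
end

section
/- In the query model in ℝ with n ≥ 2 objects and maximum speed v > 0: for every query schedule q : ℕ → Fin n, every valid trajectory family f, and every time t ≥ 1, the metric diameter of the 1-center uncertainty region C t = { ((max over i of x i) + (min over i of x i))/2 | x : Fin n → ℝ with x i ∈ U i t for every i } is at least v/2. -/
theorem oneCenter_lower_any_schedule (n : ℕ) (hn : 2 ≤ n) (v : ℝ) (hv : 0 < v)
    (q : ℕ → Fin n)
    (f : Fin n → ℕ → ℝ) (hf : ∀ i t, |f i (t + 1) - f i t| ≤ v)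
    (t : ℕ) (ht : 1 ≤ t) :
    v / 2 ≤ Metric.diam { m : ℝ | ∃ x : Fin n → ℝ,
        (∀ i, x i ∈ uncReg v f q i t) ∧
        m = ((⨆ i, x i) + (⨅ i, x i)) / 2 } := by
  haveI : Nonempty (Fin n) := ⟨⟨0, by omega⟩⟩
  have bA : ∀ x : Fin n → ℝ, BddAbove (Set.range x) := fun x => (Set.finite_range x).bddAbove
  have bB : ∀ x : Fin n → ℝ, BddBelow (Set.range x) := fun x => (Set.finite_range x).bddBelow
  set s : Fin n → ℝ := fun i => sPt v f q i t with hs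
  set e : Fin n → ℝ := fun i => ePt v f q i t with he
  have hse : ∀ i, s i ≤ e i := by
    intro i
    have : 0 ≤ v * ((t - lastObs q i t : ℕ) : ℝ) := by positivity
    simp only [hs, he, sPt, ePt]
    linarith
  have hw : ∀ i, i ≠ q t → s i + 2 * v ≤ e i := by
    intro i hi
    have h1 : lastObs q i t ≠ t := by
      intro h
      rcases (Nat.findGreatest_eq_iff.1 h).2.1 (by omega) with h | h
      · omega
      · exact hi h.symm
    have h2 : lastObs q i t ≤ t := Nat.findGreatest_le t
    have h3 : (1 : ℝ) ≤ ((t - lastObs q i t : ℕ) : ℝ) := by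
      exact_mod_cast (by omega : 1 ≤ t - lastObs q i t)
    have : v * 1 ≤ v * ((t - lastObs q i t : ℕ) : ℝ) := by gcongr
    simp only [hs, he, sPt, ePt]
    linarith
  set C := { m : ℝ | ∃ x : Fin n → ℝ,
        (∀ i, x i ∈ uncReg v f q i t) ∧
        m = ((⨆ i, x i) + (⨅ i, x i)) / 2 } with hC
  have hbd : Bornology.IsBounded C := by
    refine (Metric.isBounded_Icc (((⨆ i, s i) + (⨅ i, s i)) / 2)
      (((⨆ i, e i) + (⨅ i, e i)) / 2)).subset ?_
    rintro m ⟨x, hx, rfl⟩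
    have h1 := ciSup_mono (bA x) (fun i => (hx i).1)
    have h2 := ciInf_mono (bB s) (fun i => (hx i).1)
    have h3 := ciSup_mono (bA e) (fun i => (hx i).2)
    have h4 := ciInf_mono (bB x) (fun i => (hx i).2)
    constructor
    · linarith
    · linarith
  have hsC : ((⨆ i, s i) + (⨅ i, s i)) / 2 ∈ C := ⟨s, fun i => ⟨le_rfl, hse i⟩, rfl⟩
  have heC : ((⨆ i, e i) + (⨅ i, e i)) / 2 ∈ C := ⟨e, fun i => ⟨hse i, le_rfl⟩, rfl⟩
  have hd := Metric.dist_le_diam_of_mem hbd heC hsC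
  rw [Real.dist_eq] at hd
  have hd' := (le_abs_self _).trans hd
  have m1 : (⨆ i, s i) ≤ ⨆ i, e i := ciSup_mono (bA e) hse
  have m2 : (⨅ i, s i) ≤ ⨅ i, e i := ciInf_mono (bB s) hse
  obtain ⟨k, hk⟩ := exists_eq_ciSup_of_finite (f := s)
  obtain ⟨l, hl⟩ := exists_eq_ciInf_of_finite (f := e)
  by_cases hkq : k = q t
  · by_cases hlq : l = q t
    · haveI : Nontrivial (Fin n) := Fin.nontrivial_iff_two_le.2 hn
      obtain ⟨j, hj⟩ := exists_ne (q t)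
      have a1 := le_ciSup (bA e) j
      have a2 := ciInf_le (bB s) j
      have a3 := hw j hj
      have a4 := hse (q t)
      rw [hkq] at hk
      rw [hlq] at hl
      linarith
    · have a1 := hw l hlq
      have a2 := ciInf_le (bB s) l
      linarith
  · have a1 := hw k hkq
    have a2 := le_ciSup (bA e) k
    linarith
end

section
/- In the query model in ℝ with n ≥ 2 objects and maximum speed v > 0, suppose all objects are static at the origin, i.e., f i t = 0 for all i and t. Then for every query schedule q : ℕ → Fin n and every time t ≥ n−1, the metric diameter of the 1-center uncertainty region C t = { ((max over i of x i) + (min over i of x i))/2 | x : Fin n → ℝ with x i ∈ U i t for every i } is at least v·(n−1). -/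
theorem exists_stale {n : ℕ} (hn : 2 ≤ n) (q : ℕ → Fin n) (t : ℕ) (ht : n - 1 ≤ t) :
    ∃ j : Fin n, n - 1 ≤ t - lastObs q j t := by
  have hc : ((Finset.Ioc (t - (n - 1)) t).image q).card < (Finset.univ : Finset (Fin n)).card := by
    refine lt_of_le_of_lt Finset.card_image_le ?_
    rw [Nat.card_Ioc, Finset.card_univ, Fintype.card_fin]
    omega
  obtain ⟨j, -, hj⟩ := Finset.exists_mem_notMem_of_card_lt_card hc
  refine ⟨j, ?_⟩
  have hle : lastObs q j t ≤ t := Nat.findGreatest_le t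
  have hs : lastObs q j t = 0 ∨ q (lastObs q j t) = j :=
    Nat.findGreatest_spec (P := fun s => s = 0 ∨ q s = j) (Nat.zero_le t) (Or.inl rfl)
  by_contra hcon
  rcases hs with h0 | h1
  · omega
  · apply hj
    rw [Finset.mem_image]
    refine ⟨_, ?_, h1⟩
    rw [Finset.mem_Ioc]
    omega

theorem single_sup_inf {n : ℕ} (hn : 2 ≤ n) (j : Fin n) (a : ℝ) :
    (⨆ i, (if i = j then a else 0 : ℝ)) + (⨅ i, (if i = j then a else 0 : ℝ)) = a := by
  haveI : Nontrivial (Fin n) := Fin.nontrivial_iff_two_le.2 hn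
  obtain ⟨k, hk⟩ := exists_ne j
  have hS : (⨆ i, (if i = j then a else 0 : ℝ)) = max a 0 := by
    apply le_antisymm
    · refine ciSup_le fun i => ?_
      split_ifs <;> simp
    · apply max_le
      · simpa using le_ciSup (f := fun i => (if i = j then a else 0 : ℝ)) (Set.finite_range _).bddAbove j
      · simpa [hk] using le_ciSup (f := fun i => (if i = j then a else 0 : ℝ)) (Set.finite_range _).bddAbove k
  have hI : (⨅ i, (if i = j then a else 0 : ℝ)) = min a 0 := by
    apply le_antisymm
    · apply le_min
      · simpa using ciInf_le (f := fun i => (if i = j then a else 0 : ℝ)) (Set.finite_range _).bddBelow j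
      · simpa [hk] using ciInf_le (f := fun i => (if i = j then a else 0 : ℝ)) (Set.finite_range _).bddBelow k
    · refine le_ciInf fun i => ?_
      split_ifs <;> simp
  rw [hS, hI, max_add_min, add_zero]

theorem oneCenter_static_lower (n : ℕ) (hn : 2 ≤ n) (v : ℝ) (hv : 0 < v)
    (f : Fin n → ℕ → ℝ) (hf : ∀ i t, f i t = 0)
    (q : ℕ → Fin n) (t : ℕ) (ht : n - 1 ≤ t) :
    v * ((n : ℝ) - 1) ≤ Metric.diam { m : ℝ | ∃ x : Fin n → ℝ,
        (∀ i, x i ∈ uncReg v f q i t) ∧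
        m = ((⨆ i, x i) + (⨅ i, x i)) / 2 } := by
  obtain ⟨j, hj⟩ := exists_stale hn q t ht
  haveI : Nonempty (Fin n) := ⟨j⟩
  have hj' : (n : ℝ) - 1 ≤ ((t - lastObs q j t : ℕ) : ℝ) := by
    have : ((n - 1 : ℕ) : ℝ) ≤ ((t - lastObs q j t : ℕ) : ℝ) := by exact_mod_cast hj
    rwa [Nat.cast_sub (by omega), Nat.cast_one] at this
  have hn1 : (0 : ℝ) ≤ (n : ℝ) - 1 := by
    have : (2 : ℝ) ≤ n := by exact_mod_cast hn
    linarith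
  have hA0 : 0 ≤ v * ((n : ℝ) - 1) := mul_nonneg hv.le hn1
  have hA1 : v * ((n : ℝ) - 1) ≤ v * ((t - lastObs q j t : ℕ) : ℝ) :=
    mul_le_mul_of_nonneg_left hj' hv.le
  have key : ∀ a : ℝ, |a| ≤ v * ((n : ℝ) - 1) → a / 2 ∈ { m : ℝ | ∃ x : Fin n → ℝ,
        (∀ i, x i ∈ uncReg v f q i t) ∧
        m = ((⨆ i, x i) + (⨅ i, x i)) / 2 } := by
    intro a ha
    obtain ⟨ha1, ha2⟩ := abs_le.1 ha
    refine ⟨fun i => if i = j then a else 0, fun i => ?_, by rw [single_sup_inf hn]⟩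
    simp only [uncReg, sPt, ePt, hf, Set.mem_Icc]
    by_cases hi : i = j
    · subst hi
      simp only [if_true]
      constructor <;> linarith
    · have : 0 ≤ v * ((t - lastObs q i t : ℕ) : ℝ) := mul_nonneg hv.le (Nat.cast_nonneg _)
      simp only [hi, if_false]
      constructor <;> linarith
  have hb : Bornology.IsBounded { m : ℝ | ∃ x : Fin n → ℝ,
        (∀ i, x i ∈ uncReg v f q i t) ∧
        m = ((⨆ i, x i) + (⨅ i, x i)) / 2 } := by
    refine (Metric.isBounded_Icc (-(v * t)) (v * t)).subset ?_
    rintro m ⟨x, hx, rfl⟩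
    have hx' : ∀ i, -(v * t) ≤ x i ∧ x i ≤ v * t := by
      intro i
      have h := hx i
      simp only [uncReg, sPt, ePt, hf, Set.mem_Icc] at h
      have h2 : v * ((t - lastObs q i t : ℕ) : ℝ) ≤ v * t :=
        mul_le_mul_of_nonneg_left (by exact_mod_cast Nat.sub_le _ _) hv.le
      constructor <;> linarith [h.1, h.2]
    have s1 : (⨆ i, x i) ≤ v * t := ciSup_le fun i => (hx' i).2
    have s2 : -(v * t) ≤ ⨅ i, x i := le_ciInf fun i => (hx' i).1
    have s3 : x j ≤ ⨆ i, x i := le_ciSup (Set.finite_range x).bddAbove j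
    have s4 : (⨅ i, x i) ≤ x j := ciInf_le (Set.finite_range x).bddBelow j
    have := hx' j
    constructor <;> linarith [this.1, this.2]
  have h1 := key (v * ((n : ℝ) - 1)) (abs_of_nonneg hA0).le
  have h2 := key (-(v * ((n : ℝ) - 1))) (by rw [abs_neg, abs_of_nonneg hA0])
  have h3 := Metric.dist_le_diam_of_mem hb h1 h2
  rw [Real.dist_eq] at h3
  refine le_trans ?_ ((le_abs_self _).trans h3)
  linarith
end

section
/- In the query model in ℝ with n ≥ 2 objects and maximum speed v > 0, suppose all objects are static at the origin, i.e., f i t = 0 for all i and t. Let k = ⌊n/2⌋ + 1, and for a time t let s i t and e i t denote the left and right endpoints of U i t. Then for every query schedule q : ℕ → Fin n and every time t ≥ ⌊n/2⌋, the k-th smallest value among (e i t)_{i : Fin n} minus the k-th smallest value among (s i t)_{i : Fin n} is at least v·⌊n/2⌋. -/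
theorem oneMedian_static_lower (n : ℕ) (hn : 2 ≤ n) (v : ℝ) (hv : 0 < v)
    (f : Fin n → ℕ → ℝ) (hf : ∀ i t, f i t = 0)
    (q : ℕ → Fin n) (t : ℕ) (ht : n / 2 ≤ t) :
    v * ((n / 2 : ℕ) : ℝ) ≤
      (fun i => ePt v f q i t) (Tuple.sort (fun i => ePt v f q i t) ⟨n / 2, by omega⟩)
      - (fun i => sPt v f q i t) (Tuple.sort (fun i => sPt v f q i t) ⟨n / 2, by omega⟩) := by
  have hlast : ∀ i, lastObs q i t ≤ t := fun i => Nat.findGreatest_le t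
  have hspec : ∀ i, lastObs q i t = 0 ∨ q (lastObs q i t) = i := fun i =>
    Nat.findGreatest_spec (P := fun s => s = 0 ∨ q s = i) (Nat.zero_le t) (Or.inl rfl)
  have he : ∀ i, ePt v f q i t = v * ((t - lastObs q i t : ℕ) : ℝ) := fun i => by
    simp only [ePt, hf, zero_add]
  have hs : ∀ i, sPt v f q i t ≤ 0 := fun i => by
    simp only [sPt, hf, zero_sub]
    have : 0 ≤ v * ((t - lastObs q i t : ℕ) : ℝ) := by positivity
    linarith
  have hmono := Tuple.monotone_sort (fun i => ePt v f q i t)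
  have hS := hs (Tuple.sort (fun i => sPt v f q i t) ⟨n / 2, by omega⟩)
  generalize Tuple.sort (fun i => ePt v f q i t) = σ at hmono ⊢
  have key : n / 2 ≤ t - lastObs q (σ ⟨n / 2, by omega⟩) t := by
    by_contra hlt
    push Not at hlt
    have hd : ∀ j : Fin (n / 2 + 1),
        t - lastObs q (σ ⟨j.1, by omega⟩) t < n / 2 := fun j => by
      have h := hmono (show (⟨j.1, by omega⟩ : Fin n) ≤ ⟨n / 2, by omega⟩ from
        Nat.le_of_lt_succ j.2)
      simp only [Function.comp, he] at h
      have h2 := le_of_mul_le_mul_left h hv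
      exact lt_of_le_of_lt (by exact_mod_cast h2) hlt
    have hinj : Function.Injective
        (fun j : Fin (n / 2 + 1) => (⟨_, hd j⟩ : Fin (n / 2))) := by
      intro a b hab
      have hab' := congrArg Fin.val hab
      dsimp only at hab'
      have ha := hd a
      have hb := hd b
      have la := hlast (σ ⟨a.1, by omega⟩)
      have lb := hlast (σ ⟨b.1, by omega⟩)
      have e : lastObs q (σ ⟨a.1, by omega⟩) t = lastObs q (σ ⟨b.1, by omega⟩) t := by omega
      have qa := (hspec (σ ⟨a.1, by omega⟩)).resolve_left (by omega)
      have qb := (hspec (σ ⟨b.1, by omega⟩)).resolve_left (by omega)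
      rw [e] at qa
      have h := σ.injective (qa.symm.trans qb)
      exact Fin.ext (Fin.mk.inj h)
    have := Fintype.card_le_of_injective _ hinj
    simp at this
  have hE : v * ((n / 2 : ℕ) : ℝ) ≤ ePt v f q (σ ⟨n / 2, by omega⟩) t := by
    rw [he]
    exact mul_le_mul_of_nonneg_left (by exact_mod_cast key) hv.le
  show _ ≤ ePt v f q (σ ⟨n / 2, by omega⟩) t - sPt v f q _ t
  linarith
end

section
/- In the query model in ℝ with n ≥ 2 objects, maximum speed v > 0, and the round-robin schedule q t = t mod n: for every valid trajectory family f and every time t ≥ n−1, the metric diameter of the centroid uncertainty region { (1/n)·∑_{i} x i | x : Fin n → ℝ with x i ∈ U i t for every i } equals exactly v·(n−1). -/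
theorem rr_lastObs_mod (n : ℕ) (hn : 0 < n) (i : Fin n) (t : ℕ) (ht : n - 1 ≤ t) :
    lastObs (roundRobin n hn) i t % n = i.val := by
  have hi := i.isLt
  have h1 : i.val ≤ lastObs (roundRobin n hn) i t := by
    apply Nat.le_findGreatest (by omega)
    right
    ext
    exact Nat.mod_eq_of_lt hi
  have h2 : lastObs (roundRobin n hn) i t = 0 ∨
      roundRobin n hn (lastObs (roundRobin n hn) i t) = i :=
    Nat.findGreatest_spec (P := fun s => s = 0 ∨ roundRobin n hn s = i)
      (m := 0) (n := t) (Nat.zero_le _) (Or.inl rfl)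
  rcases h2 with h | h
  · rw [h] at h1 ⊢
    simp
    omega
  · exact congrArg Fin.val h

theorem rr_lag_lt (n : ℕ) (hn : 0 < n) (i : Fin n) (t : ℕ) (ht : n - 1 ≤ t) :
    t - lastObs (roundRobin n hn) i t < n := by
  by_contra hc
  have h0 := rr_lastObs_mod n hn i t ht
  have h1 : lastObs (roundRobin n hn) i t + n ≤ lastObs (roundRobin n hn) i t := by
    conv_rhs => unfold lastObs
    apply Nat.le_findGreatest (by omega)
    right
    ext
    simp [roundRobin, h0]
  omega

theorem rr_lag_sum (n : ℕ) (hn : 0 < n) (t : ℕ) (ht : n - 1 ≤ t) :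
    (∑ i : Fin n, ((t - lastObs (roundRobin n hn) i t : ℕ) : ℝ)) * 2 = n * ((n : ℝ) - 1) := by
  let g : Fin n → Fin n := fun i => ⟨_, rr_lag_lt n hn i t ht⟩
  have hg : Function.Injective g := by
    intro i j hij
    have h : t - lastObs (roundRobin n hn) i t = t - lastObs (roundRobin n hn) j t :=
      congrArg Fin.val hij
    have a : lastObs (roundRobin n hn) i t ≤ t := Nat.findGreatest_le _
    have b : lastObs (roundRobin n hn) j t ≤ t := Nat.findGreatest_le _
    have e : lastObs (roundRobin n hn) i t = lastObs (roundRobin n hn) j t := by omega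
    ext
    rw [← rr_lastObs_mod n hn i t ht, ← rr_lastObs_mod n hn j t ht, e]
  have hb : Function.Bijective g := Finite.injective_iff_bijective.mp hg
  have h1 : ∑ i : Fin n, (t - lastObs (roundRobin n hn) i t) = ∑ i : Fin n, i.val :=
    hb.sum_comp (fun i : Fin n => i.val)
  have h2 : (∑ i : Fin n, i.val) * 2 = n * (n - 1) := by
    rw [Fin.sum_univ_eq_sum_range (fun i => i), Finset.sum_range_id_mul_two]
  rw [← h1] at h2
  have h3 := congrArg (Nat.cast : ℕ → ℝ) h2
  rw [Nat.cast_mul, Nat.cast_mul, Nat.cast_sum, Nat.cast_sub (by omega : 1 ≤ n)] at h3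
  exact_mod_cast h3

theorem roundRobin_centroid_diam_eq (n : ℕ) (hn : 2 ≤ n) (v : ℝ) (hv : 0 < v)
    (f : Fin n → ℕ → ℝ) (hf : ∀ i t, |f i (t + 1) - f i t| ≤ v)
    (t : ℕ) (ht : n - 1 ≤ t) :
    Metric.diam { m : ℝ | ∃ x : Fin n → ℝ,
        (∀ i, x i ∈ uncReg v f (roundRobin n (by omega)) i t) ∧
        m = (1 / (n : ℝ)) * ∑ i, x i }
      = v * ((n : ℝ) - 1) := by
  have hn0 : 0 < n := by omega
  have hnR : (0 : ℝ) < n := by exact_mod_cast hn0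
  set q := roundRobin n hn0 with hq
  set A := (1 / (n : ℝ)) * ∑ i, sPt v f q i t with hA
  set B := (1 / (n : ℝ)) * ∑ i, ePt v f q i t with hB
  have hle : ∀ i, sPt v f q i t ≤ ePt v f q i t := by
    intro i
    have : 0 ≤ v * ((t - lastObs q i t : ℕ) : ℝ) := by positivity
    unfold sPt ePt
    linarith
  have hBA : B - A = v * ((n : ℝ) - 1) := by
    have hs := rr_lag_sum n hn0 t ht
    rw [hA, hB, ← mul_sub, ← Finset.sum_sub_distrib]
    have : ∀ i ∈ Finset.univ, ePt v f q i t - sPt v f q i t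
        = v * 2 * ((t - lastObs q i t : ℕ) : ℝ) := by
      intro i _
      unfold sPt ePt
      ring
    rw [Finset.sum_congr rfl this, ← Finset.mul_sum, mul_assoc v, mul_comm 2, hs]
    field_simp
  have hAB : A ≤ B := by
    have : (1 : ℝ) ≤ n := by exact_mod_cast hn0
    nlinarith
  rw [← hBA]
  have hsub : { m : ℝ | ∃ x : Fin n → ℝ, (∀ i, x i ∈ uncReg v f q i t) ∧
        m = (1 / (n : ℝ)) * ∑ i, x i } ⊆ Set.Icc A B := by
    rintro m ⟨x, hx, rfl⟩
    constructor
    · exact mul_le_mul_of_nonneg_left (Finset.sum_le_sum fun i _ => (hx i).1) (by positivity)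
    · exact mul_le_mul_of_nonneg_left (Finset.sum_le_sum fun i _ => (hx i).2) (by positivity)
  apply le_antisymm
  · rw [← Real.diam_Icc hAB]
    exact Metric.diam_mono hsub (Metric.isBounded_Icc A B)
  · have := Metric.dist_le_diam_of_mem ((Metric.isBounded_Icc A B).subset hsub)
      (x := B) (y := A) ⟨_, fun i => ⟨hle i, le_rfl⟩, hB⟩ ⟨_, fun i => ⟨le_rfl, hle i⟩, hA⟩
    rw [Real.dist_eq] at this
    exact (le_abs_self _).trans this
end

section
/- In the query model in ℝ with n ≥ 2 objects and maximum speed v > 0: for every query schedule q : ℕ → Fin n, every valid trajectory family f, and every time t ≥ n−1, the metric diameter of the centroid uncertainty region { (1/n)·∑_{i} x i | x : Fin n → ℝ with x i ∈ U i t for every i } is at least v·(n−1). -/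
lemma age_count {n : ℕ} (q : ℕ → Fin n) (t k : ℕ) (hk : k < t) :
    (Finset.univ.filter (fun i => t - lastObs q i t ≤ k)).card ≤ k + 1 := by
  have hsub : Finset.univ.filter (fun i => t - lastObs q i t ≤ k) ⊆
      (Finset.range (k+1)).image (fun j => q (t - j)) := by
    intro i hi
    simp only [Finset.mem_filter, Finset.mem_univ, true_and] at hi
    have hle : lastObs q i t ≤ t := Nat.findGreatest_le t
    have hs : lastObs q i t = 0 ∨ q (lastObs q i t) = i :=
      Nat.findGreatest_spec (P := fun s => s = 0 ∨ q s = i) (Nat.zero_le t) (Or.inl rfl)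
    rw [Finset.mem_image]
    refine ⟨t - lastObs q i t, by simp; omega, ?_⟩
    have e : t - (t - lastObs q i t) = lastObs q i t := by omega
    simp only [e]
    rcases hs with h | h
    · omega
    · exact h
  calc _ ≤ _ := Finset.card_le_card hsub
    _ ≤ _ := Finset.card_image_le
    _ = k + 1 := by simp

lemma age_sum {n : ℕ} (q : ℕ → Fin n) (t : ℕ) (ht : n - 1 ≤ t) :
    n * (n - 1) ≤ 2 * ∑ i, (t - lastObs q i t) := by
  have h1 : ∀ i : Fin n, ∑ k ∈ Finset.range (n-1), (if k < t - lastObs q i t then 1 else 0)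
      ≤ t - lastObs q i t := by
    intro i
    rw [← Finset.card_filter]
    calc _ ≤ (Finset.range (t - lastObs q i t)).card := by
          apply Finset.card_le_card
          intro k hk
          simp only [Finset.mem_filter, Finset.mem_range] at hk ⊢
          exact hk.2
      _ = _ := by simp
  have h2 := Finset.sum_le_sum (fun i (_ : i ∈ Finset.univ) => h1 i)
  rw [Finset.sum_comm] at h2
  have h3 : ∑ k ∈ Finset.range (n-1), (n - 1 - k) ≤ ∑ k ∈ Finset.range (n-1),
      ∑ i : Fin n, (if k < t - lastObs q i t then 1 else 0) := by
    apply Finset.sum_le_sum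
    intro k hk
    rw [Finset.mem_range] at hk
    rw [← Finset.card_filter]
    have hc := age_count q t k (by omega)
    have hp := Finset.card_filter_add_card_filter_not (s := (Finset.univ : Finset (Fin n)))
      (fun i => t - lastObs q i t ≤ k)
    simp only [not_le, Finset.card_univ, Fintype.card_fin] at hp
    omega
  have h4 : ∀ m : ℕ, 2 * ∑ k ∈ Finset.range m, (m - k) = (m + 1) * m := by
    intro m
    induction m with
    | zero => simp
    | succ m ih =>
      rw [Finset.sum_range_succ']
      simp only [Nat.add_sub_add_right, Nat.sub_zero]
      rw [mul_add, ih]; ring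
  have h5 := h4 (n-1)
  rcases Nat.eq_zero_or_pos n with h | h
  · subst h; simp
  · rw [Nat.sub_add_cancel h] at h5
    omega

theorem centroid_lower_any_schedule (n : ℕ) (hn : 2 ≤ n) (v : ℝ) (hv : 0 < v)
    (q : ℕ → Fin n)
    (f : Fin n → ℕ → ℝ) (hf : ∀ i t, |f i (t + 1) - f i t| ≤ v)
    (t : ℕ) (ht : n - 1 ≤ t) :
    v * ((n : ℝ) - 1) ≤ Metric.diam { m : ℝ | ∃ x : Fin n → ℝ,
        (∀ i, x i ∈ uncReg v f q i t) ∧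
        m = (1 / (n : ℝ)) * ∑ i, x i } := by
  have hn0 : (0 : ℝ) < n := by exact_mod_cast (by omega : 0 < n)
  have hse : ∀ i, sPt v f q i t ≤ ePt v f q i t := by
    intro i
    have : 0 ≤ v * ((t - lastObs q i t : ℕ) : ℝ) := by positivity
    unfold sPt ePt; linarith
  have hage : (n : ℝ) * ((n : ℝ) - 1) ≤ 2 * ∑ i, ((t - lastObs q i t : ℕ) : ℝ) := by
    have h := age_sum q t ht
    have h' : ((n * (n - 1) : ℕ) : ℝ) ≤ ((2 * ∑ i, (t - lastObs q i t) : ℕ) : ℝ) :=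
      Nat.cast_le.mpr h
    rw [Nat.cast_mul, Nat.cast_sub (by omega : 1 ≤ n), Nat.cast_mul, Nat.cast_sum] at h'
    exact_mod_cast h'
  have hb : Bornology.IsBounded { m : ℝ | ∃ x : Fin n → ℝ,
        (∀ i, x i ∈ uncReg v f q i t) ∧
        m = (1 / (n : ℝ)) * ∑ i, x i } := by
    apply (Metric.isBounded_Icc ((1 / (n : ℝ)) * ∑ i, sPt v f q i t)
      ((1 / (n : ℝ)) * ∑ i, ePt v f q i t)).subset
    rintro m ⟨x, hx, rfl⟩
    constructor
    · exact mul_le_mul_of_nonneg_left (Finset.sum_le_sum fun i _ => (hx i).1) (by positivity)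
    · exact mul_le_mul_of_nonneg_left (Finset.sum_le_sum fun i _ => (hx i).2) (by positivity)
  have hd := Metric.dist_le_diam_of_mem hb
    (x := (1 / (n : ℝ)) * ∑ i, ePt v f q i t) (y := (1 / (n : ℝ)) * ∑ i, sPt v f q i t)
    ⟨_, fun i => ⟨hse i, le_rfl⟩, rfl⟩ ⟨_, fun i => ⟨le_rfl, hse i⟩, rfl⟩
  refine le_trans ?_ hd
  rw [Real.dist_eq]
  refine le_trans ?_ (le_abs_self _)
  rw [← mul_sub, ← Finset.sum_sub_distrib]
  have e : ∑ i, (ePt v f q i t - sPt v f q i t)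
      = v * (2 * ∑ i, ((t - lastObs q i t : ℕ) : ℝ)) := by
    rw [Finset.mul_sum, Finset.mul_sum]
    apply Finset.sum_congr rfl
    intro i _
    unfold ePt sPt; ring
  rw [e, one_div, ← div_eq_inv_mul, le_div_iff₀ hn0]
  have := mul_le_mul_of_nonneg_left hage hv.le
  linarith
end
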